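/- Let G = (V,E) be a directed graph, let D ≥ 0 and d ≥ 0 be integers, and let P = ⟨v_0,…,v_ℓ⟩ be a path in G with ℓ ≤ D. Suppose x is a dD-limited ancestor of P: x ⪯_{dD} v_i for some index i, and v_j ⋠_{dD} x for every index j. Let a be the least index with x ⪯_{dD} v_a. Then: for every index i < a, x ⋠_{dD} v_i (and v_i ⋠_{dD} x), so the prefix ⟨v_0,…,v_{a−1}⟩ lies entirely in V_R = { w : x ⋠_{dD} w and w ⋠_{dD} x }; and for every index i ≥ a, x ⪯_{(d+1)D} v_i and v_i ⋠_{dD} x, so the suffix ⟨v_a,…,v_ℓ⟩ lies entirely in V_S ∪ F⁺, where V_S = { w : x ⪯_{dD} w and w ⋠_{dD} x } is the core successor set and F⁺ = { w : x ⪯_{(d+1)D} w and x ⋠_{dD} w } is the fringe set. -/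

import Mathlib

/-- `ReachLen E k u v`: there is a directed path from `u` to `v` with exactly `k` arcs. -/
def ReachLen {V : Type*} (E : V → V → Prop) : ℕ → V → V → Prop
  | 0, u, v => u = v
  | n + 1, u, v => ∃ w, E u w ∧ ReachLen E n w v

/-- `ReachWithin E c u v` (`u ⪯_c v`): there is a directed path from `u` to `v`
consisting of at most `c` arcs. -/
def ReachWithin {V : Type*} (E : V → V → Prop) (c : ℕ) (u v : V) : Prop :=
  ∃ k ≤ c, ReachLen E k u v

theorem ReachLen.trans {V : Type*} {E : V → V → Prop} {m n : ℕ} {u w z : V}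
    (h₁ : ReachLen E m u w) (h₂ : ReachLen E n w z) : ReachLen E (m + n) u z := by
  induction m generalizing u with
  | zero =>
    cases h₁
    simpa using h₂
  | succ m ih =>
    obtain ⟨y, hy, h⟩ := h₁
    rw [Nat.succ_add]
    exact ⟨y, hy, ih h⟩

theorem ReachWithin.trans {V : Type*} {E : V → V → Prop} {b c : ℕ} {u w z : V}
    (h₁ : ReachWithin E b u w) (h₂ : ReachWithin E c w z) : ReachWithin E (b + c) u z := by
  obtain ⟨k, hk, h₁⟩ := h₁
  obtain ⟨l, hl, h₂⟩ := h₂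
  exact ⟨k + l, Nat.add_le_add hk hl, h₁.trans h₂⟩

theorem reachLen_of_path {V : Type*} {E : V → V → Prop} {ℓ : ℕ} {v : ℕ → V}
    (hpath : ∀ i < ℓ, E (v i) (v (i + 1))) (i k : ℕ) (h : i + k ≤ ℓ) :
    ReachLen E k (v i) (v (i + k)) := by
  induction k generalizing i with
  | zero => rfl
  | succ k ih =>
    refine ⟨v (i + 1), hpath i (by omega), ?_⟩
    exact Nat.add_right_comm i 1 k ▸ ih (i + 1) (by omega)

/-- Case 3 of the paper's Lemma 4.4: if `x` is a `dD`-limited ancestor of a path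
`⟨v 0, …, v ℓ⟩` with `ℓ ≤ D`, and `a` is the least index with `x ⪯_{dD} v a`, then the
prefix before `a` lies in `V_R` (unrelated at distance `dD`), and the suffix from `a`
on satisfies `x ⪯_{(d+1)D} v i` and `v i ⋠_{dD} x`, hence lies in the union of the
core successor set `V_S` and the fringe set `F⁺`. -/
theorem path_split_ancestor_distance_limited {V : Type*} (E : V → V → Prop)
    (D d ℓ : ℕ) (hℓD : ℓ ≤ D)
    (v : ℕ → V) (hpath : ∀ i < ℓ, E (v i) (v (i + 1)))
    (x : V)
    (hanc : (∃ i ≤ ℓ, ReachWithin E (d * D) x (v i)) ∧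
      ∀ j ≤ ℓ, ¬ ReachWithin E (d * D) (v j) x)
    (a : ℕ)
    (ha : a ≤ ℓ ∧ ReachWithin E (d * D) x (v a) ∧
      ∀ i < a, ¬ ReachWithin E (d * D) x (v i)) :
    (∀ i < a,
      (¬ ReachWithin E (d * D) x (v i) ∧ ¬ ReachWithin E (d * D) (v i) x) ∧
      v i ∈ {w : V | ¬ ReachWithin E (d * D) x w ∧ ¬ ReachWithin E (d * D) w x}) ∧
    (∀ i, a ≤ i → i ≤ ℓ →
      (ReachWithin E ((d + 1) * D) x (v i) ∧ ¬ ReachWithin E (d * D) (v i) x) ∧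
      v i ∈ {w : V | ReachWithin E (d * D) x w ∧ ¬ ReachWithin E (d * D) w x} ∪
            {w : V | ReachWithin E ((d + 1) * D) x w ∧ ¬ ReachWithin E (d * D) x w}) := by
  obtain ⟨-, hdesc⟩ := hanc
  obtain ⟨haℓ, hxa, hmin⟩ := ha
  refine ⟨fun i hi => ?_, fun i hai hiℓ => ?_⟩
  · have h := And.intro (hmin i hi) (hdesc i (by omega))
    exact ⟨h, h⟩
  · have hfar : ReachWithin E ((d + 1) * D) x (v i) := by
      have hstep : ReachWithin E D (v a) (v i) := by
        refine ⟨i - a, by omega, ?_⟩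
        simpa only [Nat.add_sub_cancel' hai] using
          reachLen_of_path hpath a (i - a) (by omega)
      rw [Nat.succ_mul]
      exact hxa.trans hstep
    refine ⟨⟨hfar, hdesc i hiℓ⟩, ?_⟩
    by_cases hx : ReachWithin E (d * D) x (v i)
    · exact Or.inl ⟨hx, hdesc i hiℓ⟩
    · exact Or.inr ⟨hfar, hx⟩
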